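/- Diagonal-to-off-diagonal relation within a block (upper diagonal entry): let λ be a Young diagram with at most d rows, let i, j ∈ [d], and let k ∈ [d−1] satisfy λ_k = λ_{k+1}. Then g(k, k) = (1 + 1/Δ) · g(k, k+1). -/

import Mathlib

open Finset

/-- The Weyl dimension polynomial `WD_p(mu) = prod_{1 <= a < b <= p} ((mu_a - mu_b) + (b - a))/(b - a)`
of the integer tuple `(mu 1, ..., mu p)`. -/
def weylDim (p : ℕ) (μ : ℕ → ℤ) : ℚ :=
  ∏ a ∈ Finset.Icc 1 p, ∏ b ∈ Finset.Icc (a + 1) p,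
    (((μ a : ℚ) - (μ b : ℚ)) + ((b : ℚ) - (a : ℚ))) / ((b : ℚ) - (a : ℚ))

/-- `addBox μ y = μ + e_y`: the tuple `μ` with `1` added in coordinate `y`. -/
def addBox (μ : ℕ → ℤ) (y : ℕ) : ℕ → ℤ := fun x => μ x + if x = y then 1 else 0

/-- The dimension ratio `D^μ_{k→y} = WD_k(μ + e_y)/WD_k(μ)` for `y ≤ k`, and `0` for `k < y`
(division by zero evaluates to `0`). -/
def dimRatio (μ : ℕ → ℤ) (k y : ℕ) : ℚ :=
  if y ≤ k then weylDim k (addBox μ y) / weylDim k μ else 0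

def intOf (lam : ℕ → ℕ) : ℕ → ℤ := fun x => (lam x : ℤ)

/-- `Δ = (λ_j − λ_i) + (i − j) + δ_{ij}`. -/
def Del (lam : ℕ → ℕ) (i j : ℕ) : ℚ :=
  (((lam j : ℚ) - (lam i : ℚ)) + ((i : ℚ) - (j : ℚ))) + (if i = j then 1 else 0)

/-- The partial-sum function `F(s, t)` of squared two-step Clebsch–Gordan coefficients. -/
def Fcoef (lam : ℕ → ℕ) (i j : ℕ) (s t : ℕ) : ℚ :=
  if s ≤ t then dimRatio (intOf lam) s i * dimRatio (addBox (intOf lam) i) t j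
  else
    dimRatio (intOf lam) t j * dimRatio (addBox (intOf lam) j) s i
      + 1 / Del lam i j ^ 2 *
          (dimRatio (intOf lam) t i * dimRatio (addBox (intOf lam) i) s j
            - dimRatio (intOf lam) t j * dimRatio (addBox (intOf lam) j) s i)

/-- The squared two-step Clebsch–Gordan coefficient `g(k, ℓ)`. -/
def gcoef (lam : ℕ → ℕ) (i j : ℕ) (k l : ℕ) : ℚ :=
  Fcoef lam i j k l - Fcoef lam i j (k - 1) l - Fcoef lam i j k (l - 1)
    + Fcoef lam i j (k - 1) (l - 1)

/-- `D_{s→ij}`. -/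
def dimR2 (lam : ℕ → ℕ) (i j s : ℕ) : ℚ :=
  if max i j ≤ s then weylDim s (addBox (addBox (intOf lam) i) j) / weylDim s (intOf lam)
  else 0

/-- `C^{λ+e_i}_j = λ_j + δ_{ij} − j`. -/
def rowContentAdd (lam : ℕ → ℕ) (i j : ℕ) : ℚ :=
  ((lam j : ℚ) + (if i = j then 1 else 0)) - (j : ℚ)

lemma weylDim_succ (n : ℕ) (μ : ℕ → ℤ) :
    weylDim (n + 1) μ = weylDim n μ * ∏ a ∈ Finset.Icc 1 n,
      (((μ a : ℚ) - (μ (n + 1) : ℚ)) + (((n + 1 : ℕ) : ℚ) - (a : ℚ))) /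
        (((n + 1 : ℕ) : ℚ) - (a : ℚ)) := by
  unfold weylDim
  rw [Finset.prod_Icc_succ_top (by omega), Finset.Icc_eq_empty (a := n + 1 + 1) (by omega),
    Finset.prod_empty, mul_one, ← Finset.prod_mul_distrib]
  refine Finset.prod_congr rfl fun a ha => ?_
  rw [Finset.mem_Icc] at ha
  rw [Finset.prod_Icc_succ_top (by omega)]

lemma weylDim_eq_zero_iff (p : ℕ) (μ : ℕ → ℤ) :
    weylDim p μ = 0 ↔ ∃ a b, 1 ≤ a ∧ a < b ∧ b ≤ p ∧ μ a - a = μ b - b := by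
  unfold weylDim
  simp only [Finset.prod_eq_zero_iff, Finset.mem_Icc]
  constructor
  · rintro ⟨a, ha, b, hb, h⟩
    refine ⟨a, b, ha.1, by omega, hb.2, ?_⟩
    have hne : (b : ℚ) - a ≠ 0 := by
      rw [sub_ne_zero]
      exact_mod_cast (by omega : b ≠ a)
    have h' := (div_eq_zero_iff.1 h).resolve_right hne
    qify
    linarith
  · rintro ⟨a, b, ha, hab, hb, h⟩
    refine ⟨a, ⟨ha, by omega⟩, b, ⟨hab, hb⟩, ?_⟩
    qify at h
    rw [div_eq_zero_iff]
    left
    linarith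

lemma dimRatio_of_lt (μ : ℕ → ℤ) {k y : ℕ} (h : k < y) : dimRatio μ k y = 0 :=
  if_neg (by omega)

lemma dimRatio_of_le (μ : ℕ → ℤ) {k y : ℕ} (h : y ≤ k) :
    dimRatio μ k y = weylDim k (addBox μ y) / weylDim k μ :=
  if_pos h

lemma dimRatio_succ_mul (μ : ℕ → ℤ) {n y : ℕ} (hy : y ∈ Finset.Icc 1 n)
    (hμ : ∀ a ∈ Finset.Icc 1 n, μ a - a ≠ μ (n + 1) - (n + 1)) :
    dimRatio μ (n + 1) y * (((μ y : ℚ) - y) - (μ (n + 1) - (n + 1))) =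
      dimRatio μ n y * (((μ y : ℚ) - y) - (μ (n + 1) - (n + 1)) + 1) := by
  have hy' := Finset.mem_Icc.1 hy
  rw [dimRatio_of_le _ hy'.2, dimRatio_of_le _ (by omega : y ≤ n + 1), weylDim_succ, weylDim_succ]
  set P := ∏ a ∈ Finset.Icc 1 n,
    (((μ a : ℚ) - (μ (n + 1) : ℚ)) + (((n + 1 : ℕ) : ℚ) - (a : ℚ))) /
      (((n + 1 : ℕ) : ℚ) - (a : ℚ)) with hP
  set P' := ∏ a ∈ Finset.Icc 1 n,
    (((addBox μ y a : ℚ) - (addBox μ y (n + 1) : ℚ)) + (((n + 1 : ℕ) : ℚ) - (a : ℚ))) /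
      (((n + 1 : ℕ) : ℚ) - (a : ℚ)) with hP'
  have hden : ∀ a ∈ Finset.Icc 1 n, (((n + 1 : ℕ) : ℚ) - (a : ℚ)) ≠ 0 := fun a ha => by
    rw [Finset.mem_Icc] at ha
    rw [sub_ne_zero]
    exact_mod_cast (by omega : n + 1 ≠ a)
  have hP0 : P ≠ 0 := by
    rw [hP, Finset.prod_ne_zero_iff]
    intro a ha
    refine div_ne_zero (fun h => hμ a ha ?_) (hden a ha)
    qify
    push_cast at h
    linarith
  have hrel : P' * (((μ y : ℚ) - y) - (μ (n + 1) - (n + 1))) =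
      P * (((μ y : ℚ) - y) - (μ (n + 1) - (n + 1)) + 1) := by
    have hrest : ∀ a ∈ (Finset.Icc 1 n).erase y,
        (((addBox μ y a : ℚ) - (addBox μ y (n + 1) : ℚ)) + (((n + 1 : ℕ) : ℚ) - (a : ℚ))) /
          (((n + 1 : ℕ) : ℚ) - (a : ℚ)) =
        (((μ a : ℚ) - (μ (n + 1) : ℚ)) + (((n + 1 : ℕ) : ℚ) - (a : ℚ))) /
          (((n + 1 : ℕ) : ℚ) - (a : ℚ)) := fun a ha => by
      simp only [addBox, if_neg (Finset.ne_of_mem_erase ha), if_neg (by omega : ¬ n + 1 = y),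
        add_zero]
    rw [hP, hP', ← Finset.mul_prod_erase _ _ hy, ← Finset.mul_prod_erase _ _ hy,
      Finset.prod_congr rfl hrest]
    have hd := hden y hy
    simp only [addBox, if_true, if_neg (by omega : n + 1 ≠ y)]
    field_simp
    push_cast
    ring
  by_cases hW : weylDim n μ = 0
  · simp [hW]
  · field_simp
    linear_combination weylDim n (addBox μ y) * hrel

lemma addBox_comm (μ : ℕ → ℤ) (x y : ℕ) :
    addBox (addBox μ x) y = addBox (addBox μ y) x := by
  funext a
  simp only [addBox]
  ring

/-- If `weylDim p (μ + e_i) = 0`, then row `i` collides with another row; the last hypothesis says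
that this is not row `j`, so the collision persists in `μ + e_i + e_j`. -/
lemma dimRatio_mul_dimRatio_addBox {μ : ℕ → ℤ} {p i j : ℕ} (hi : i ≤ p) (hj : j ≤ p)
    (hμ : ∀ a b, 1 ≤ a → a < b → b ≤ p → μ b - b < μ a - a)
    (hij : i ≠ j) (h : μ i - i + 1 ≠ μ j - j) :
    dimRatio μ p i * dimRatio (addBox μ i) p j =
      weylDim p (addBox (addBox μ i) j) / weylDim p μ := by
  rw [dimRatio_of_le _ hi, dimRatio_of_le _ hj]
  by_cases hW : weylDim p (addBox μ i) = 0
  · have hW' : weylDim p (addBox (addBox μ i) j) = 0 := by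
      rw [weylDim_eq_zero_iff] at hW ⊢
      obtain ⟨a, b, ha, hab, hb, he⟩ := hW
      refine ⟨a, b, ha, hab, hb, ?_⟩
      have := hμ a b ha hab hb
      simp only [addBox] at he ⊢
      by_cases hai : a = i
      · subst hai
        simp only [if_true, if_neg (by omega : b ≠ a)] at he
        omega
      · by_cases hbi : b = i
        · subst hbi
          have haj : a ≠ j := by
            rintro rfl
            simp only [if_true, if_neg hai] at he
            omega
          simpa [haj, hij] using he
        · simp only [if_neg hai, if_neg hbi] at he
          omega
    simp [hW, hW']
  · field_simp

section Partition

variable {d : ℕ} {lam : ℕ → ℕ}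

lemma shifted_lt (hlam : ∀ k, 1 ≤ k → k + 1 ≤ d → lam (k + 1) ≤ lam k) (a b : ℕ)
    (ha : 1 ≤ a) (hab : a < b) (hb : b ≤ d) : intOf lam b - b < intOf lam a - a := by
  have hle : lam b ≤ lam a := by
    induction b, hab using Nat.le_induction with
    | base => exact hlam a ha hb
    | succ n hn ih => exact (hlam n (by omega) hb).trans (ih (by omega))
  simp only [intOf]
  omega

lemma Del_eq (i j : ℕ) :
    Del lam i j = (addBox (intOf lam) i j - j : ℤ) - (intOf lam i - i : ℤ) := by
  simp only [Del, addBox, intOf, eq_comm (a := j)]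
  push_cast
  ring

lemma Del_ne_zero (hlam : ∀ k, 1 ≤ k → k + 1 ≤ d → lam (k + 1) ≤ lam k) {i j : ℕ}
    (hi : i ∈ Finset.Icc 1 d) (hj : j ∈ Finset.Icc 1 d) : Del lam i j ≠ 0 := by
  rw [Finset.mem_Icc] at hi hj
  rw [Del_eq, sub_ne_zero]
  norm_cast
  simp only [addBox]
  rcases lt_trichotomy i j with h | h | h
  · have := shifted_lt hlam i j hi.1 h hj.2
    rw [if_neg (by omega)]
    omega
  · subst h
    simp
  · have := shifted_lt hlam j i hj.1 h hi.2
    rw [if_neg (by omega)]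
    omega

lemma one_sub_Del_mul_dimRatio_comm (hlam : ∀ k, 1 ≤ k → k + 1 ≤ d → lam (k + 1) ≤ lam k)
    {i j k : ℕ} (hi : i ≤ k) (hj : j ≤ k) (hk : k ≤ d) :
    (1 - 1 / Del lam i j ^ 2) *
        (dimRatio (intOf lam) k j * dimRatio (addBox (intOf lam) j) k i) =
      (1 - 1 / Del lam i j ^ 2) *
        (dimRatio (intOf lam) k i * dimRatio (addBox (intOf lam) i) k j) := by
  by_cases hij : i = j
  · rw [hij]
  by_cases hD : Del lam i j ^ 2 = 1
  · simp [hD]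
  · have hμ : ∀ a b, 1 ≤ a → a < b → b ≤ k → intOf lam b - b < intOf lam a - a :=
      fun a b ha hab hb => shifted_lt hlam a b ha hab (hb.trans hk)
    rw [Del_eq] at hD
    simp only [addBox, if_neg (Ne.symm hij)] at hD
    rw [dimRatio_mul_dimRatio_addBox hi hj hμ hij, dimRatio_mul_dimRatio_addBox hj hi hμ
      (Ne.symm hij), addBox_comm]
    · intro h
      apply hD
      rw [← h]
      push_cast
      ring
    · intro h
      apply hD
      rw [add_zero, ← h]
      push_cast
      ring

/-- Within a block, the values `F(s, t)` with `s, t ∈ {k - 1, k, k + 1}` entering `g(k, k)` and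
`g(k, k + 1)` are all explicit multiples of `F(k, k)`. -/
lemma upper_diagonal_relation_of_le
    (hlam : ∀ k, 1 ≤ k → k + 1 ≤ d → lam (k + 1) ≤ lam k)
    {i j n : ℕ} (hi : i ∈ Finset.Icc 1 (n + 1)) (hj : j ∈ Finset.Icc 1 (n + 1))
    (hn : n + 2 ≤ d) (hblock : lam (n + 1) = lam (n + 2)) :
    gcoef lam i j (n + 1) (n + 1) =
      (1 + 1 / Del lam i j) * gcoef lam i j (n + 1) (n + 2) := by
  have hi' := Finset.mem_Icc.1 hi
  have hj' := Finset.mem_Icc.1 hj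
  have hD0 := Del_ne_zero hlam (i := i) (j := j) (Finset.mem_Icc.2 ⟨hi'.1, by omega⟩)
    (Finset.mem_Icc.2 ⟨hj'.1, by omega⟩)
  have hcomm := one_sub_Del_mul_dimRatio_comm hlam hi'.2 hj'.2 (by omega : n + 1 ≤ d)
  have hlt := shifted_lt hlam
  set z : ℚ := ((intOf lam i : ℚ) - i) - (intOf lam (n + 1) - (n + 1)) with hz
  set w : ℚ := ((addBox (intOf lam) i j : ℚ) - j) - (intOf lam (n + 1) - (n + 1)) with hw
  have hz0 : 0 ≤ z := by
    have : intOf lam (n + 1) - (n + 1 : ℕ) ≤ intOf lam i - i := by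
      rcases hi'.2.lt_or_eq with h | h
      · exact (hlt i (n + 1) hi'.1 h (by omega)).le
      · rw [h]
    qify at this
    linarith
  have hw0 : 0 ≤ w := by
    have : intOf lam (n + 1) - (n + 1 : ℕ) ≤ addBox (intOf lam) i j - j := by
      have : intOf lam j ≤ addBox (intOf lam) i j := by
        simp only [addBox]
        split_ifs <;> omega
      rcases hj'.2.lt_or_eq with h | h
      · have := hlt j (n + 1) hj'.1 h (by omega)
        omega
      · rw [h] at this ⊢
        omega
    qify at this
    linarith
  have hDel : Del lam i j = w - z := by
    rw [Del_eq, hw, hz]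
    push_cast
    ring
  have hf : dimRatio (intOf lam) (n + 1) i * z = dimRatio (intOf lam) n i * (z + 1) := by
    rcases hi'.2.lt_or_eq with h | h
    · refine dimRatio_succ_mul _ (Finset.mem_Icc.2 ⟨hi'.1, by omega⟩) fun a ha => ?_
      rw [Finset.mem_Icc] at ha
      have := hlt a (n + 1) ha.1 (by omega) (by omega)
      push_cast at this
      omega
    · rw [dimRatio_of_lt _ (by omega : n < i), hz, h]
      push_cast
      ring
  have hf' : (1 - 1 / Del lam i j ^ 2) * (dimRatio (intOf lam) (n + 1) j * w) =
      (1 - 1 / Del lam i j ^ 2) * (dimRatio (intOf lam) n j * (w + 1)) := by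
    by_cases hij : i = j
    · have : Del lam i j = 1 := by simp [Del, hij]
      simp [this]
    have hwj : w = ((intOf lam j : ℚ) - j) - (intOf lam (n + 1) - (n + 1)) := by
      rw [hw]
      simp [addBox, Ne.symm hij]
    congr 1
    rcases hj'.2.lt_or_eq with h | h
    · rw [hwj]
      refine dimRatio_succ_mul _ (Finset.mem_Icc.2 ⟨hj'.1, by omega⟩) fun a ha => ?_
      rw [Finset.mem_Icc] at ha
      have := hlt a (n + 1) ha.1 (by omega) (by omega)
      push_cast at this
      omega
    · rw [dimRatio_of_lt _ (by omega : n < j), hwj, h]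
      push_cast
      ring
  have hh : dimRatio (intOf lam) n i * (dimRatio (addBox (intOf lam) i) (n + 1) j * w) =
      dimRatio (intOf lam) n i * (dimRatio (addBox (intOf lam) i) n j * (w + 1)) := by
    rcases hi'.2.lt_or_eq with hin | hin
    · congr 1
      have hbox : addBox (intOf lam) i (n + 1) = intOf lam (n + 1) := by
        simp only [addBox, if_neg (by omega : ¬ n + 1 = i), add_zero]
      rcases hj'.2.lt_or_eq with h | h
      · rw [hw, ← hbox]
        refine dimRatio_succ_mul _ (Finset.mem_Icc.2 ⟨hj'.1, by omega⟩) fun a ha => ?_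
        rw [Finset.mem_Icc] at ha
        have := hlt a (n + 1) ha.1 (by omega) (by omega)
        rw [hbox]
        simp only [addBox]
        push_cast at this
        split_ifs <;> omega
      · rw [dimRatio_of_lt _ (by omega : n < j), hw, h, hbox]
        push_cast
        ring
    · simp [dimRatio_of_lt _ (by omega : n < i)]
  have hh2 : dimRatio (addBox (intOf lam) i) (n + 2) j * (w + 1) =
      dimRatio (addBox (intOf lam) i) (n + 1) j * (w + 2) := by
    have hbox : addBox (intOf lam) i (n + 2) = intOf lam (n + 1) := by
      simp only [addBox, intOf, if_neg (by omega : ¬ n + 2 = i), hblock, add_zero]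
    have key := dimRatio_succ_mul (addBox (intOf lam) i) hj fun a ha => by
      rw [Finset.mem_Icc] at ha
      have := hlt a (n + 2) ha.1 (by omega) (by omega)
      simp only [addBox, if_neg (by omega : n + 1 + 1 ≠ i)]
      push_cast at this ⊢
      split_ifs <;> grind
    rw [show n + 1 + 1 = n + 2 from rfl, hbox] at key
    push_cast at key
    rw [hw]
    linear_combination key
  simp only [gcoef, Fcoef, Nat.add_sub_cancel, show n + 2 - 1 = n + 1 from rfl, le_refl, if_true,
    if_pos (by omega : n ≤ n + 1), if_pos (by omega : n ≤ n + 2),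
    if_pos (by omega : n + 1 ≤ n + 2), if_neg (by omega : ¬ n + 1 ≤ n)]
  rw [hDel] at hD0 hcomm hf' ⊢
  generalize dimRatio (intOf lam) (n + 1) i = f at *
  generalize dimRatio (intOf lam) n i = f₀ at *
  generalize dimRatio (intOf lam) (n + 1) j = g at *
  generalize dimRatio (intOf lam) n j = g₀ at *
  generalize dimRatio (addBox (intOf lam) i) (n + 1) j = h at *
  generalize dimRatio (addBox (intOf lam) i) n j = h₀ at *
  generalize dimRatio (addBox (intOf lam) i) (n + 2) j = h₂ at *
  generalize dimRatio (addBox (intOf lam) j) (n + 1) i = e at *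
  clear_value z w
  have hz1 : z + 1 ≠ 0 := by positivity
  have hw1 : w + 1 ≠ 0 := by positivity
  have e1 : f₀ = f * z / (z + 1) := by rw [eq_div_iff hz1, hf]
  have e2 : h₂ = h * (w + 2) / (w + 1) := by rw [eq_div_iff hw1, hh2]
  have e3 : f₀ * h₀ = f₀ * (h * w / (w + 1)) := by
    rw [← mul_div_assoc, eq_div_iff hw1]
    linear_combination -hh
  have e4 : (1 - 1 / (w - z) ^ 2) * (g₀ * e) =
      (1 - 1 / (w - z) ^ 2) * (f * h) * (w / (w + 1)) := by
    rw [← mul_div_assoc, eq_div_iff hw1]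
    linear_combination (-e) * hf' + w * hcomm
  rw [show g₀ * e + 1 / (w - z) ^ 2 * (f₀ * h - g₀ * e) =
    (1 - 1 / (w - z) ^ 2) * (g₀ * e) + 1 / (w - z) ^ 2 * (f₀ * h) by ring, e4, e3, e2, e1]
  field_simp
  ring

end Partition

theorem two_step_upper_diagonal_relation
    (d : ℕ) (hd : 1 ≤ d) (lam : ℕ → ℕ)
    (hlam : ∀ k, 1 ≤ k → k + 1 ≤ d → lam (k + 1) ≤ lam k)
    (i j : ℕ) (hi : i ∈ Finset.Icc 1 d) (hj : j ∈ Finset.Icc 1 d)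
    (k : ℕ) (hk1 : 1 ≤ k) (hk2 : k + 1 ≤ d) (hblock : lam k = lam (k + 1)) :
    gcoef lam i j k k = (1 + 1 / Del lam i j) * gcoef lam i j k (k + 1) := by
  obtain ⟨n, rfl⟩ : ∃ n, k = n + 1 := ⟨k - 1, by omega⟩
  rw [Finset.mem_Icc] at hi hj
  by_cases hik : n + 1 < i
  · simp [gcoef, Fcoef, dimRatio_of_lt _ hik, dimRatio_of_lt _ (by omega : n < i),
      (by omega : n ≤ n + 1 + 1)]
  by_cases hjk : n + 1 < j
  · have hg : gcoef lam i j (n + 1) (n + 1) = 0 := by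
      simp [gcoef, Fcoef, dimRatio_of_lt _ hjk, dimRatio_of_lt _ (by omega : n < j)]
    have hg' : gcoef lam i j (n + 1) (n + 2) =
        (dimRatio (intOf lam) (n + 1) i - dimRatio (intOf lam) n i) *
          dimRatio (addBox (intOf lam) i) (n + 2) j := by
      simp [gcoef, Fcoef, dimRatio_of_lt _ hjk, (by omega : n ≤ n + 2)]
      ring
    rw [hg, show n + 1 + 1 = n + 2 from rfl, hg']
    rcases (by omega : n + 2 < j ∨ j = n + 2) with h | rfl
    · simp [dimRatio_of_lt _ h]
    rcases (by omega : i = n + 1 ∨ i ≤ n) with rfl | hin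
    · have : Del lam (n + 1) (n + 2) = -1 := by
        simp [Del, hblock]
        ring
      simp [this]
    · have : weylDim (n + 2) (addBox (addBox (intOf lam) i) (n + 2)) = 0 := by
        rw [weylDim_eq_zero_iff]
        refine ⟨n + 1, n + 2, by omega, by omega, le_rfl, ?_⟩
        simp only [addBox, intOf, hblock, if_neg (by omega : ¬ n + 1 = i),
          if_neg (by omega : ¬ n + 2 = i), if_neg (by omega : ¬ n + 1 = n + 2), if_true]
        push_cast
        ring
      simp [dimRatio_of_le _ le_rfl, this]
  · exact upper_diagonal_relation_of_le hlam (Finset.mem_Icc.2 ⟨hi.1, by omega⟩)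
      (Finset.mem_Icc.2 ⟨hj.1, by omega⟩) hk2 hblock
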